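/- Let γ > 0, δ > 0, η > 0, ε > 0, a > 0 be real constants, and let s, ρ̃, w, d ∈ ℝ with |d| ≤ ε. Then s·( -(δ+η)·sgn(s)·w + a·w·ρ̃ + (w - 1)·(δ+η)·sgn(s) ) + (1/γ)·ρ̃·( d - γ·a·s·w - (ε+1)·sgn(ρ̃) ) ≤ -(δ+η)·|s| - (1/γ)·|ρ̃|. -/

import Mathlib

theorem Real.self_mul_sign_eq_abs (x : ℝ) : x * Real.sign x = |x| := by
  rcases lt_trichotomy x 0 with h | rfl | h
  · rw [Real.sign_of_neg h, abs_of_neg h, mul_neg_one]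
  · simp
  · rw [Real.sign_of_pos h, abs_of_pos h, mul_one]

theorem lyapunov_derivative_estimate
    (γ δ η ε a : ℝ) (hγ : 0 < γ) (hδ : 0 < δ) (hη : 0 < η) (hε : 0 < ε) (ha : 0 < a)
    (s ρ w d : ℝ) (hd : |d| ≤ ε) :
    s * (-(δ + η) * Real.sign s * w + a * w * ρ + (w - 1) * (δ + η) * Real.sign s) +
        (1 / γ) * ρ * (d - γ * a * s * w - (ε + 1) * Real.sign ρ) ≤
      -(δ + η) * |s| - (1 / γ) * |ρ| := by
  have hρd : ρ * d ≤ ε * |ρ| := calc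
    ρ * d ≤ |ρ * d| := le_abs_self _
    _ = |d| * |ρ| := by rw [abs_mul, mul_comm]
    _ ≤ ε * |ρ| := by gcongr
  calc
    _ = -(δ + η) * (s * Real.sign s) +
        (1 / γ) * (ρ * d - (ε + 1) * (ρ * Real.sign ρ)) := by
      field_simp
      ring
    _ = -(δ + η) * |s| - (1 / γ) * |ρ| + (1 / γ) * (ρ * d - ε * |ρ|) := by
      rw [Real.self_mul_sign_eq_abs, Real.self_mul_sign_eq_abs]
      ring
    _ ≤ -(δ + η) * |s| - (1 / γ) * |ρ| :=
      add_le_of_nonpos_right <|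
        mul_nonpos_of_nonneg_of_nonpos (by positivity) (sub_nonpos.mpr hρd)
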